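/- Let E be a row-finite directed graph and K any field, and suppose L_K(E) is a simple ring. If E^0 is finite, then the center of L_K(E) equals K·1 (the scalar multiples of the identity Σ_{v ∈ E^0} v). If E^0 is infinite, then the center of L_K(E) is {0}. -/

import Mathlib

set_option synthInstance.maxHeartbeats 1000000
set_option maxHeartbeats 1000000

/-- Generators of the Leavitt path algebra: vertices, edges, and ghost edges. -/
inductive LPAGen (V E : Type) : Type
  | vertex : V → LPAGen V E
  | edge : E → LPAGen V E
  | ghost : E → LPAGen V E

/-- The defining relations of the Leavitt path algebra of the graph with vertex set `V`,
edge set `E`, and source and range maps `s r : E → V`.  The (CK2) relation is imposed at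
every regular vertex, i.e. every vertex emitting finitely many but at least one edge. -/
inductive LPARel (K : Type) [Field K] {V E : Type} (s r : E → V) :
    FreeAlgebra K (LPAGen V E) → FreeAlgebra K (LPAGen V E) → Prop
  | vertex_self (v : V) :
      LPARel K s r (FreeAlgebra.ι K (LPAGen.vertex v) * FreeAlgebra.ι K (LPAGen.vertex v))
        (FreeAlgebra.ι K (LPAGen.vertex v))
  | vertex_ne {v w : V} (h : v ≠ w) :
      LPARel K s r (FreeAlgebra.ι K (LPAGen.vertex v) * FreeAlgebra.ι K (LPAGen.vertex w)) 0
  | edge_left (e : E) :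
      LPARel K s r (FreeAlgebra.ι K (LPAGen.vertex (s e)) * FreeAlgebra.ι K (LPAGen.edge e))
        (FreeAlgebra.ι K (LPAGen.edge e))
  | edge_right (e : E) :
      LPARel K s r (FreeAlgebra.ι K (LPAGen.edge e) * FreeAlgebra.ι K (LPAGen.vertex (r e)))
        (FreeAlgebra.ι K (LPAGen.edge e))
  | ghost_left (e : E) :
      LPARel K s r (FreeAlgebra.ι K (LPAGen.vertex (r e)) * FreeAlgebra.ι K (LPAGen.ghost e))
        (FreeAlgebra.ι K (LPAGen.ghost e))
  | ghost_right (e : E) :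
      LPARel K s r (FreeAlgebra.ι K (LPAGen.ghost e) * FreeAlgebra.ι K (LPAGen.vertex (s e)))
        (FreeAlgebra.ι K (LPAGen.ghost e))
  | ck1_self (e : E) :
      LPARel K s r (FreeAlgebra.ι K (LPAGen.ghost e) * FreeAlgebra.ι K (LPAGen.edge e))
        (FreeAlgebra.ι K (LPAGen.vertex (r e)))
  | ck1_ne {e f : E} (h : e ≠ f) :
      LPARel K s r (FreeAlgebra.ι K (LPAGen.ghost e) * FreeAlgebra.ι K (LPAGen.edge f)) 0
  | ck2 (v : V) (h : {e : E | s e = v}.Finite) (hne : {e : E | s e = v}.Nonempty) :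
      LPARel K s r (FreeAlgebra.ι K (LPAGen.vertex v))
        (h.toFinset.sum fun e => FreeAlgebra.ι K (LPAGen.edge e) * FreeAlgebra.ι K (LPAGen.ghost e))

/-- The unital algebra presented by the Leavitt path algebra generators and relations
(for a graph with possibly infinitely many vertices this is the unitalization of the
Leavitt path algebra; the honest Leavitt path algebra is the non-unital subalgebra `lpa`
generated by the generators, defined below). -/
abbrev LPAU (K : Type) [Field K] {V E : Type} (s r : E → V) : Type :=
  RingQuot (LPARel K s r)

variable (K : Type) [Field K] {V E : Type} (s r : E → V)

/-- The canonical image of a generator. -/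
def gen (g : LPAGen V E) : LPAU K s r :=
  RingQuot.mkAlgHom K (LPARel K s r) (FreeAlgebra.ι K g)

def vertexEl (v : V) : LPAU K s r := gen K s r (LPAGen.vertex v)
def edgeEl (e : E) : LPAU K s r := gen K s r (LPAGen.edge e)
def ghostEl (e : E) : LPAU K s r := gen K s r (LPAGen.ghost e)

/-- The Leavitt path algebra `L_K(E)` of an arbitrary graph, realized (honestly, i.e.
without an adjoined unit) as the non-unital subalgebra generated by the vertices, edges
and ghost edges. -/
def lpa : NonUnitalSubalgebra K (LPAU K s r) :=
  NonUnitalAlgebra.adjoin K (Set.range (gen K s r))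

def vertexIn (v : V) : ↥(lpa K s r) :=
  ⟨vertexEl K s r v, NonUnitalAlgebra.subset_adjoin K (Set.mem_range_self _)⟩

def edgeIn (e : E) : ↥(lpa K s r) :=
  ⟨edgeEl K s r e, NonUnitalAlgebra.subset_adjoin K (Set.mem_range_self _)⟩

def ghostIn (e : E) : ↥(lpa K s r) :=
  ⟨ghostEl K s r e, NonUnitalAlgebra.subset_adjoin K (Set.mem_range_self _)⟩

instance lpaNonUnitalRing : NonUnitalRing ↥(lpa K s r) := inferInstance
instance lpaAddCommGroup : AddCommGroup ↥(lpa K s r) := inferInstance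
instance lpaModule : Module K ↥(lpa K s r) := inferInstance

/-- A subset of a (possibly non-unital) ring is a two-sided ideal. -/
def IsTwoSidedIdealSet {R : Type} [Zero R] [Add R] [Neg R] [Mul R] (I : Set R) : Prop :=
  (0 : R) ∈ I ∧ (∀ a ∈ I, ∀ b ∈ I, a + b ∈ I) ∧ (∀ a ∈ I, -a ∈ I) ∧
    ∀ x : R, ∀ a ∈ I, x * a ∈ I ∧ a * x ∈ I

section SimpleRing

variable {R : Type} [NonUnitalRing R]

theorem central_mul_eq_zero_of_simple
    (hs : ∀ I : Set R, IsTwoSidedIdealSet I → I = {0} ∨ I = Set.univ)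
    {z x : R} (hz : ∀ y, z * y = y * z) (hx : x ≠ 0) (hzx : z * x = 0) (y : R) : z * y = 0 := by
  have hI : IsTwoSidedIdealSet {y : R | z * y = 0} := by
    refine ⟨mul_zero z, fun a ha b hb => ?_, fun a ha => ?_, fun x a ha => ⟨?_, ?_⟩⟩ <;>
      simp only [Set.mem_ofPred_eq] at *
    · rw [mul_add, ha, hb, add_zero]
    · rw [mul_neg, ha, neg_zero]
    · rw [← mul_assoc, hz, mul_assoc, ha, mul_zero]
    · rw [← mul_assoc, ha, zero_mul]
  rcases hs _ hI with h | h
  · exact absurd (h.subset hzx) hx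
  · exact h.superset (Set.mem_univ y)

theorem exists_central_inverse_of_simple
    (hs : ∀ I : Set R, IsTwoSidedIdealSet I → I = {0} ∨ I = Set.univ)
    {u z : R} (hu : ∀ x, u * x = x ∧ x * u = x) (hz : ∀ y, z * y = y * z) (hz0 : z ≠ 0) :
    ∃ y, (∀ x, y * x = x * y) ∧ z * y = u := by
  have hI : IsTwoSidedIdealSet {y : R | ∃ x, z * x = y} := by
    refine ⟨⟨0, mul_zero z⟩, ?_, ?_, ?_⟩
    · rintro _ ⟨a, rfl⟩ _ ⟨b, rfl⟩
      exact ⟨a + b, mul_add _ _ _⟩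
    · rintro _ ⟨a, rfl⟩
      exact ⟨-a, mul_neg _ _⟩
    · rintro x _ ⟨a, rfl⟩
      exact ⟨⟨x * a, by rw [← mul_assoc, hz, mul_assoc]⟩, ⟨a * x, (mul_assoc _ _ _).symm⟩⟩
  rcases hs _ hI with h | h
  · exact absurd (h.subset ⟨u, (hu z).2⟩) hz0
  · obtain ⟨y, hy⟩ := h.superset (Set.mem_univ u)
    refine ⟨y, fun x => ?_, hy⟩
    by_contra hne
    refine hz0 ?_
    rw [← (hu z).2]
    refine central_mul_eq_zero_of_simple hs hz (sub_ne_zero.mpr hne) ?_ u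
    rw [mul_sub, ← mul_assoc, ← mul_assoc, hy, hz x, mul_assoc, hy, (hu x).1, (hu x).2, sub_self]

end SimpleRing

open AddMonoidAlgebra in
theorem eq_single_of_mul_eq_single {R : Type} [Semiring R] {f g : AddMonoidAlgebra R ℤ} {u : R}
    (hf : f ≠ 0) (hg : g ≠ 0) (hfg : f * g = single 0 u)
    (h : ∀ a b, f.coeff a ≠ 0 → g.coeff b ≠ 0 → f.coeff a * g.coeff b ≠ 0) :
    ∃ N, ∀ n, f.coeff n ≠ 0 → n = N := by
  have hfs : f.coeff.support.Nonempty := by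
    rw [Finsupp.support_nonempty_iff]
    intro h0
    exact hf (AddMonoidAlgebra.ext (by simp [h0]))
  have hgs : g.coeff.support.Nonempty := by
    rw [Finsupp.support_nonempty_iff]
    intro h0
    exact hg (AddMonoidAlgebra.ext (by simp [h0]))
  have key : ∀ a ∈ f.coeff.support, ∀ b ∈ g.coeff.support,
      UniqueAdd f.coeff.support g.coeff.support a b → a + b = 0 := by
    intro a ha b hb hu
    have h1 := coeff_mul_add_of_uniqueAdd hu
    by_contra hne
    rw [hfg, coeff_single, Finsupp.single_eq_of_ne hne] at h1
    exact h a b (Finsupp.mem_support_iff.mp ha) (Finsupp.mem_support_iff.mp hb) h1.symm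
  have hmax := key _ (Finset.max'_mem _ hfs) _ (Finset.max'_mem _ hgs) (by
    intro a b ha hb hab
    have := Finset.le_max' _ a ha
    have := Finset.le_max' _ b hb
    omega)
  have hmin := key _ (Finset.min'_mem _ hfs) _ (Finset.min'_mem _ hgs) (by
    intro a b ha hb hab
    have := Finset.min'_le _ a ha
    have := Finset.min'_le _ b hb
    omega)
  have hg' := Finset.min'_le_max' _ hgs
  refine ⟨f.coeff.support.max' hfs, fun n hn => ?_⟩
  have hn' := Finsupp.mem_support_iff.mpr hn
  have := Finset.le_max' _ n hn'
  have := Finset.min'_le _ n hn'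
  omega

section Relations

theorem vertexEl_mul_self (v : V) : vertexEl K s r v * vertexEl K s r v = vertexEl K s r v := by
  simpa only [vertexEl, edgeEl, ghostEl, gen, map_mul] using RingQuot.mkAlgHom_rel K (LPARel.vertex_self (K := K) (s := s) (r := r) v)

theorem vertexEl_mul_of_ne {v w : V} (h : v ≠ w) : vertexEl K s r v * vertexEl K s r w = 0 := by
  simpa only [vertexEl, edgeEl, ghostEl, gen, map_mul, map_zero] using
    RingQuot.mkAlgHom_rel K (LPARel.vertex_ne (K := K) (s := s) (r := r) h)

theorem vertexEl_mul_edgeEl (e : E) :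
    vertexEl K s r (s e) * edgeEl K s r e = edgeEl K s r e := by
  simpa only [vertexEl, edgeEl, ghostEl, gen, map_mul] using RingQuot.mkAlgHom_rel K (LPARel.edge_left (K := K) (s := s) (r := r) e)

theorem edgeEl_mul_vertexEl (e : E) :
    edgeEl K s r e * vertexEl K s r (r e) = edgeEl K s r e := by
  simpa only [vertexEl, edgeEl, ghostEl, gen, map_mul] using RingQuot.mkAlgHom_rel K (LPARel.edge_right (K := K) (s := s) (r := r) e)

theorem vertexEl_mul_ghostEl (e : E) :
    vertexEl K s r (r e) * ghostEl K s r e = ghostEl K s r e := by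
  simpa only [vertexEl, edgeEl, ghostEl, gen, map_mul] using RingQuot.mkAlgHom_rel K (LPARel.ghost_left (K := K) (s := s) (r := r) e)

theorem ghostEl_mul_vertexEl (e : E) :
    ghostEl K s r e * vertexEl K s r (s e) = ghostEl K s r e := by
  simpa only [vertexEl, edgeEl, ghostEl, gen, map_mul] using
    RingQuot.mkAlgHom_rel K (LPARel.ghost_right (K := K) (s := s) (r := r) e)

theorem ghostEl_mul_edgeEl_self (e : E) :
    ghostEl K s r e * edgeEl K s r e = vertexEl K s r (r e) := by
  simpa only [vertexEl, edgeEl, ghostEl, gen, map_mul] using RingQuot.mkAlgHom_rel K (LPARel.ck1_self (K := K) (s := s) (r := r) e)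

theorem ghostEl_mul_edgeEl_of_ne {e f : E} (h : e ≠ f) :
    ghostEl K s r e * edgeEl K s r f = 0 := by
  simpa only [vertexEl, edgeEl, ghostEl, gen, map_mul, map_zero] using
    RingQuot.mkAlgHom_rel K (LPARel.ck1_ne (K := K) (s := s) (r := r) h)

theorem vertexEl_eq_sum (v : V) (h : {e : E | s e = v}.Finite) (hne : {e : E | s e = v}.Nonempty) :
    vertexEl K s r v = h.toFinset.sum fun e => edgeEl K s r e * ghostEl K s r e := by
  simpa only [vertexEl, edgeEl, ghostEl, gen, map_mul, map_sum] using
    RingQuot.mkAlgHom_rel K (LPARel.ck2 (K := K) (s := s) (r := r) v h hne)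

theorem vertexEl_mul_edgeEl_of_ne {v : V} {e : E} (h : v ≠ s e) :
    vertexEl K s r v * edgeEl K s r e = 0 := by
  rw [← vertexEl_mul_edgeEl, ← mul_assoc, vertexEl_mul_of_ne K s r h, zero_mul]

theorem ghostEl_mul_vertexEl_of_ne {v : V} {e : E} (h : s e ≠ v) :
    ghostEl K s r e * vertexEl K s r v = 0 := by
  rw [← ghostEl_mul_vertexEl, mul_assoc, vertexEl_mul_of_ne K s r h, mul_zero]

theorem exists_algHom_of_rel {B : Type} [Ring B] [Algebra K B] (f : LPAGen V E → B)
    (h : ∀ ⦃x y⦄, LPARel K s r x y → FreeAlgebra.lift K f x = FreeAlgebra.lift K f y) :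
    ∃ φ : LPAU K s r →ₐ[K] B, ∀ g, φ (gen K s r g) = f g :=
  ⟨RingQuot.liftAlgHom K ⟨FreeAlgebra.lift K f, h⟩, fun g => by
    rw [gen, RingQuot.liftAlgHom_mkAlgHom_apply, FreeAlgebra.lift_ι_apply]⟩

end Relations

section Nonvanishing

theorem exists_index_system (hrow : ∀ v : V, {e : E | s e = v}.Finite) :
    ∃ j : E → ℕ → ℕ, (∀ e n f m, s e = s f → j e n = j f m → e = f ∧ n = m) ∧
      ∀ v, {e : E | s e = v}.Nonempty → ∀ k, ∃ e n, s e = v ∧ j e n = k := by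
  have hb : ∀ v, {e : E | s e = v}.Nonempty → Nonempty ({e : E | s e = v} × ℕ ≃ ℕ) := by
    intro v hv
    have := (hrow v).countable.to_subtype
    have := hv.to_subtype
    exact nonempty_equiv_of_countable
  let b := fun v hv => (hb v hv).some
  refine ⟨fun e n => b (s e) ⟨e, rfl⟩ (⟨e, rfl⟩, n), ?_, ?_⟩
  · intro e n f m hs h
    have transport : ∀ v (he : s e = v),
        b (s e) ⟨e, rfl⟩ (⟨e, rfl⟩, n) = b v ⟨e, he⟩ (⟨e, he⟩, n) := by
      rintro _ rfl
      rfl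
    have heq := (b (s f) ⟨f, rfl⟩).injective ((transport _ hs).symm.trans h)
    simpa using heq
  · intro v hv k
    obtain ⟨⟨⟨e, he⟩, n⟩, h⟩ := (b v hv).surjective k
    have he' : s e = v := he
    subst he'
    exact ⟨e, n, rfl, h⟩

open Classical in
theorem vertexEl_ne_zero (hrow : ∀ v : V, {e : E | s e = v}.Finite) (v : V) :
    vertexEl K s r v ≠ 0 := by
  obtain ⟨j, hinj, hsurj⟩ := exists_index_system s hrow
  let P : V → Module.End K (V × ℕ → K) := fun v =>
    { toFun := fun g x => if x.1 = v then g x else 0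
      map_add' := by intro f g; ext x; dsimp; split_ifs <;> simp
      map_smul' := by intro c f; ext x; dsimp; split_ifs <;> simp }
  let G : E → Module.End K (V × ℕ → K) := fun e =>
    { toFun := fun g x => if x.1 = r e then g (s e, j e x.2) else 0
      map_add' := by intro f g; ext x; dsimp; split_ifs <;> simp
      map_smul' := by intro c f; ext x; dsimp; split_ifs <;> simp }
  let S : E → Module.End K (V × ℕ → K) := fun e =>
    { toFun := fun g x => if h : ∃ n, x = (s e, j e n) then g (r e, h.choose) else 0
      map_add' := by intro f g; ext x; dsimp; split_ifs <;> simp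
      map_smul' := by intro c f; ext x; dsimp; split_ifs <;> simp }
  have hP : ∀ v g x, P v g x = if x.1 = v then g x else 0 := fun _ _ _ => rfl
  have hG : ∀ e g x, G e g x = if x.1 = r e then g (s e, j e x.2) else 0 := fun _ _ _ => rfl
  have hS : ∀ e g n, S e g (s e, j e n) = g (r e, n) := by
    intro e g n
    have h : ∃ m, (s e, j e n) = (s e, j e m) := ⟨n, rfl⟩
    have h2 : h.choose = n := ((hinj _ _ _ _ rfl (Prod.ext_iff.mp h.choose_spec).2).2).symm
    change (if h : ∃ m, (s e, j e n) = (s e, j e m) then g (r e, h.choose) else 0) = _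
    rw [dif_pos h, h2]
  have hS0 : ∀ e g x, (¬ ∃ n, x = (s e, j e n)) → S e g x = 0 := fun e g x h => dif_neg h
  let F : LPAGen V E → Module.End K (V × ℕ → K) := fun g =>
    match g with
    | .vertex v => P v
    | .edge e => S e
    | .ghost e => G e
  obtain ⟨φ, hφ⟩ := exists_algHom_of_rel K s r F (by
    intro x y hxy
    cases hxy <;> simp only [map_mul, map_zero, map_sum, FreeAlgebra.lift_ι_apply, F]
    case vertex_self v =>
      ext g x; simp only [Module.End.mul_apply, hP]; split_ifs <;> rfl
    case vertex_ne v w h =>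
      ext g x
      simp only [Module.End.mul_apply, hP]
      split_ifs with h1 h2
      · exact absurd (h1.symm.trans h2) h
      · rfl
      · rfl
    case edge_left e =>
      ext g x
      simp only [Module.End.mul_apply, hP]
      split_ifs with h1
      · rfl
      · rw [hS0]
        rintro ⟨n, rfl⟩
        exact h1 rfl
    case edge_right e =>
      ext g x
      simp only [Module.End.mul_apply]
      by_cases h : ∃ n, x = (s e, j e n)
      · obtain ⟨n, rfl⟩ := h
        simp [hS, hP]
      · rw [hS0 _ _ _ h, hS0 _ _ _ h]
    case ghost_left e =>
      ext g x; simp only [Module.End.mul_apply, hP, hG]; split_ifs <;> rfl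
    case ghost_right e =>
      ext g x; simp [Module.End.mul_apply, hP, hG]
    case ck1_self e =>
      ext g ⟨w, n⟩
      simp only [Module.End.mul_apply, hP, hG, hS]
      split_ifs with h
      · subst h; rfl
      · rfl
    case ck1_ne e f h =>
      ext g ⟨w, n⟩
      simp only [Module.End.mul_apply, hG]
      split_ifs with h1
      · rw [hS0]
        · rfl
        · rintro ⟨m, hm⟩
          rw [Prod.mk.injEq] at hm
          exact h (hinj _ _ _ _ hm.1 hm.2).1
      · rfl
    case ck2 v h hne =>
      ext g ⟨w, k⟩
      rw [LinearMap.sum_apply, Finset.sum_apply]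
      simp only [Module.End.mul_apply, hP]
      split_ifs with hw
      · subst hw
        obtain ⟨e, n, he, rfl⟩ := hsurj w hne k
        subst he
        rw [Finset.sum_eq_single e]
        · simp [hS, hG]
        · intro f _ hf
          apply hS0
          rintro ⟨m, hm⟩
          rw [Prod.mk.injEq] at hm
          exact hf (hinj _ _ _ _ hm.1 hm.2).1.symm
        · intro hmem
          exact absurd (by simp) hmem
      · symm
        apply Finset.sum_eq_zero
        intro e he
        apply hS0
        rintro ⟨m, hm⟩
        rw [Prod.mk.injEq] at hm
        exact hw (hm.1.trans (by simpa using he)))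
  intro h0
  have h1 : P v = 0 := by
    have := hφ (.vertex v)
    rw [← vertexEl, h0, map_zero] at this
    exact this.symm
  have h2 := congrFun (LinearMap.congr_fun h1 (fun _ => 1)) (v, 0)
  rw [hP] at h2
  simp at h2

end Nonvanishing

section Spanning

/-- The product of the edges in `a`, the vertex `v` and the ghost edges in `b`. -/
def pathMonomial (a : List E) (v : V) (b : List E) : LPAU K s r :=
  (a.map (edgeEl K s r)).prod * vertexEl K s r v * (b.map (ghostEl K s r)).prod

/-- The linear span of all path monomials. -/
def monomialSpan : Submodule K (LPAU K s r) :=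
  Submodule.span K {x | ∃ a v b, x = pathMonomial K s r a v b}

theorem pathMonomial_mem_monomialSpan (a : List E) (v : V) (b : List E) :
    pathMonomial K s r a v b ∈ monomialSpan K s r :=
  Submodule.subset_span ⟨a, v, b, rfl⟩

theorem pathMonomial_cons (e : E) (a : List E) (v : V) (b : List E) :
    pathMonomial K s r (e :: a) v b = edgeEl K s r e * pathMonomial K s r a v b := by
  simp [pathMonomial, mul_assoc]

theorem pathMonomial_concat (a : List E) (v : V) (b : List E) (e : E) :
    pathMonomial K s r a v (b ++ [e]) = pathMonomial K s r a v b * ghostEl K s r e := by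
  simp [pathMonomial, mul_assoc]

theorem pathMonomial_nil (v : V) : pathMonomial K s r [] v [] = vertexEl K s r v := by
  simp [pathMonomial]

theorem vertexEl_mul_pathMonomial (w : V) (a : List E) (v : V) (b : List E) :
    vertexEl K s r w * pathMonomial K s r a v b = pathMonomial K s r a v b ∨
      vertexEl K s r w * pathMonomial K s r a v b = 0 := by
  cases a with
  | nil =>
    simp only [pathMonomial, List.map_nil, List.prod_nil, one_mul, ← mul_assoc]
    by_cases h : w = v
    · subst h
      left
      rw [vertexEl_mul_self]
    · right
      rw [vertexEl_mul_of_ne K s r h, zero_mul]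
  | cons e a =>
    rw [pathMonomial_cons, ← mul_assoc]
    by_cases h : w = s e
    · subst h
      left
      rw [vertexEl_mul_edgeEl]
    · right
      rw [vertexEl_mul_edgeEl_of_ne K s r h, zero_mul]

theorem gen_mul_mem_monomialSpan (g : LPAGen V E) {y : LPAU K s r}
    (hy : y ∈ monomialSpan K s r) : gen K s r g * y ∈ monomialSpan K s r := by
  have hvert : ∀ w a v b,
      vertexEl K s r w * pathMonomial K s r a v b ∈ monomialSpan K s r := by
    intro w a v b
    rcases vertexEl_mul_pathMonomial K s r w a v b with h | h <;> rw [h]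
    · exact pathMonomial_mem_monomialSpan K s r a v b
    · exact zero_mem _
  induction hy using Submodule.span_induction with
  | zero => rw [mul_zero]; exact zero_mem _
  | add x y _ _ hx hy => rw [mul_add]; exact add_mem hx hy
  | smul c x _ hx => rw [mul_smul_comm]; exact Submodule.smul_mem _ c hx
  | mem x hx =>
    obtain ⟨a, v, b, rfl⟩ := hx
    cases g with
    | vertex w => exact hvert w a v b
    | edge e =>
      rw [← edgeEl, ← pathMonomial_cons]
      exact pathMonomial_mem_monomialSpan K s r _ v b
    | ghost f =>
      rw [← ghostEl]
      cases a with
      | nil =>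
        by_cases h : s f = v
        · have : ghostEl K s r f * pathMonomial K s r [] v b = pathMonomial K s r [] (r f) (f :: b) := by
            subst h
            simp only [pathMonomial, List.map_nil, List.prod_nil, one_mul, ← mul_assoc,
              List.map_cons, List.prod_cons, ghostEl_mul_vertexEl, vertexEl_mul_ghostEl]
          rw [this]
          exact pathMonomial_mem_monomialSpan K s r _ _ _
        · simp only [pathMonomial, List.map_nil, List.prod_nil, one_mul, ← mul_assoc,
            ghostEl_mul_vertexEl_of_ne K s r h, zero_mul]
          exact zero_mem _
      | cons e a =>
        rw [pathMonomial_cons, ← mul_assoc]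
        by_cases h : f = e
        · subst h
          rw [ghostEl_mul_edgeEl_self]
          exact hvert _ _ _ _
        · rw [ghostEl_mul_edgeEl_of_ne K s r h, zero_mul]
          exact zero_mem _

theorem gen_mem_monomialSpan (g : LPAGen V E) : gen K s r g ∈ monomialSpan K s r := by
  cases g with
  | vertex v =>
    rw [← vertexEl, ← pathMonomial_nil]
    exact pathMonomial_mem_monomialSpan K s r _ _ _
  | edge e =>
    have : edgeEl K s r e = pathMonomial K s r [e] (r e) [] := by
      simp [pathMonomial, edgeEl_mul_vertexEl]
    rw [← edgeEl, this]
    exact pathMonomial_mem_monomialSpan K s r _ _ _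
  | ghost e =>
    have : ghostEl K s r e = pathMonomial K s r [] (r e) [e] := by
      simp [pathMonomial, vertexEl_mul_ghostEl]
    rw [← ghostEl, this]
    exact pathMonomial_mem_monomialSpan K s r _ _ _

theorem mem_monomialSpan_of_mem_lpa {x : LPAU K s r} (hx : x ∈ lpa K s r) :
    x ∈ monomialSpan K s r := by
  have : x ∈ monomialSpan K s r ∧
      ∀ y ∈ monomialSpan K s r, x * y ∈ monomialSpan K s r := by
    induction hx using NonUnitalAlgebra.adjoin_induction with
    | mem x hx =>
      obtain ⟨g, rfl⟩ := hx
      exact ⟨gen_mem_monomialSpan K s r g, fun y hy => gen_mul_mem_monomialSpan K s r g hy⟩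
    | zero => exact ⟨zero_mem _, fun y _ => by rw [zero_mul]; exact zero_mem _⟩
    | add x y _ _ hx hy =>
      exact ⟨add_mem hx.1 hy.1, fun w hw => by
        rw [add_mul]; exact add_mem (hx.2 w hw) (hy.2 w hw)⟩
    | mul x y _ _ hx hy =>
      exact ⟨hx.2 y hy.1, fun w hw => by rw [mul_assoc]; exact hx.2 _ (hy.2 w hw)⟩
    | smul c x _ hx =>
      exact ⟨Submodule.smul_mem _ c hx.1, fun w hw => by
        rw [smul_mul_assoc]; exact Submodule.smul_mem _ c (hx.2 w hw)⟩
  exact this.1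

theorem vertexEl_mem_lpa (v : V) : vertexEl K s r v ∈ lpa K s r := (vertexIn K s r v).2
theorem edgeEl_mem_lpa (e : E) : edgeEl K s r e ∈ lpa K s r := (edgeIn K s r e).2
theorem ghostEl_mem_lpa (e : E) : ghostEl K s r e ∈ lpa K s r := (ghostIn K s r e).2

theorem pathMonomial_mem_lpa (a : List E) (v : V) (b : List E) :
    pathMonomial K s r a v b ∈ lpa K s r := by
  induction a with
  | cons e a ih =>
    rw [pathMonomial_cons]
    exact mul_mem (edgeEl_mem_lpa K s r e) ih
  | nil =>
    induction b using List.reverseRecOn with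
    | nil => rw [pathMonomial_nil]; exact vertexEl_mem_lpa K s r v
    | append_singleton b e ih =>
      rw [pathMonomial_concat]
      exact mul_mem ih (ghostEl_mem_lpa K s r e)

end Spanning

section Grading

open AddMonoidAlgebra

theorem exists_degree_algHom :
    ∃ φ : LPAU K s r →ₐ[K] AddMonoidAlgebra (LPAU K s r) ℤ,
      (∀ v, φ (vertexEl K s r v) = single 0 (vertexEl K s r v)) ∧
      (∀ e, φ (edgeEl K s r e) = single 1 (edgeEl K s r e)) ∧
      ∀ e, φ (ghostEl K s r e) = single (-1) (ghostEl K s r e) := by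
  let F : LPAGen V E → AddMonoidAlgebra (LPAU K s r) ℤ := fun g =>
    match g with
    | .vertex v => single 0 (vertexEl K s r v)
    | .edge e => single 1 (edgeEl K s r e)
    | .ghost e => single (-1) (ghostEl K s r e)
  obtain ⟨φ, hφ⟩ := exists_algHom_of_rel K s r F (by
    intro x y hxy
    cases hxy <;> simp only [map_mul, map_zero, map_sum, FreeAlgebra.lift_ι_apply, F,
      single_mul_single, zero_add, add_zero, neg_add_cancel, add_neg_cancel]
    case vertex_self v => rw [vertexEl_mul_self]
    case vertex_ne v w h => rw [vertexEl_mul_of_ne K s r h, single_zero]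
    case edge_left e => rw [vertexEl_mul_edgeEl]
    case edge_right e => rw [edgeEl_mul_vertexEl]
    case ghost_left e => rw [vertexEl_mul_ghostEl]
    case ghost_right e => rw [ghostEl_mul_vertexEl]
    case ck1_self e => rw [ghostEl_mul_edgeEl_self]
    case ck1_ne e f h => rw [ghostEl_mul_edgeEl_of_ne K s r h, single_zero]
    case ck2 v h hne => 
      rw [vertexEl_eq_sum K s r v h hne]
      exact map_sum (singleAddHom (0 : ℤ)) _ _)
  exact ⟨φ, fun v => hφ (.vertex v), fun e => hφ (.edge e), fun e => hφ (.ghost e)⟩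

/-- The grading homomorphism, multiplying edges by `T` and ghost edges by `T⁻¹`. -/
noncomputable def degreeHom : LPAU K s r →ₐ[K] AddMonoidAlgebra (LPAU K s r) ℤ :=
  (exists_degree_algHom K s r).choose

theorem degreeHom_vertexEl (v : V) :
    degreeHom K s r (vertexEl K s r v) = single 0 (vertexEl K s r v) :=
  (exists_degree_algHom K s r).choose_spec.1 v

theorem degreeHom_edgeEl (e : E) :
    degreeHom K s r (edgeEl K s r e) = single 1 (edgeEl K s r e) :=
  (exists_degree_algHom K s r).choose_spec.2.1 e

theorem degreeHom_ghostEl (e : E) :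
    degreeHom K s r (ghostEl K s r e) = single (-1) (ghostEl K s r e) :=
  (exists_degree_algHom K s r).choose_spec.2.2 e

theorem degreeHom_pathMonomial (a : List E) (v : V) (b : List E) :
    degreeHom K s r (pathMonomial K s r a v b) =
      single ((a.length : ℤ) - b.length) (pathMonomial K s r a v b) := by
  induction a with
  | cons e a ih =>
    rw [pathMonomial_cons, map_mul, degreeHom_edgeEl, ih, single_mul_single]
    congr 1
    push_cast [List.length_cons]
    ring
  | nil =>
    induction b using List.reverseRecOn with
    | nil => simp [pathMonomial_nil, degreeHom_vertexEl]
    | append_singleton b e ih =>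
      rw [pathMonomial_concat, map_mul, degreeHom_ghostEl, ih, single_mul_single]
      congr 1
      push_cast [List.length_append, List.length_singleton]
      ring

theorem sum_coeff_degreeHom {x : LPAU K s r} (hx : x ∈ lpa K s r) :
    (degreeHom K s r x).coeff.sum (fun _ a => a) = x := by
  replace hx := mem_monomialSpan_of_mem_lpa K s r hx
  induction hx using Submodule.span_induction with
  | mem x hx =>
    obtain ⟨a, v, b, rfl⟩ := hx
    rw [degreeHom_pathMonomial, coeff_single, Finsupp.sum_single_index rfl]
  | zero => simp
  | add x y _ _ hx hy =>
    rw [map_add, coeff_add, Finsupp.sum_add_index' (fun _ => rfl) (fun _ _ _ => rfl), hx, hy]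
  | smul c x _ hx =>
    rw [map_smul, coeff_smul, Finsupp.sum_smul_index' (fun _ => rfl), ← Finsupp.smul_sum, hx]

theorem coeff_degreeHom_mem_lpa {x : LPAU K s r} (hx : x ∈ lpa K s r) (n : ℤ) :
    (degreeHom K s r x).coeff n ∈ lpa K s r := by
  classical
  replace hx := mem_monomialSpan_of_mem_lpa K s r hx
  induction hx using Submodule.span_induction with
  | mem x hx =>
    obtain ⟨a, v, b, rfl⟩ := hx
    rw [degreeHom_pathMonomial, coeff_single, Finsupp.single_apply]
    split_ifs
    · exact pathMonomial_mem_lpa K s r a v b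
    · exact zero_mem _
  | zero => simp
  | add x y _ _ hx hy =>
    rw [map_add, coeff_add, Finsupp.add_apply]
    exact add_mem hx hy
  | smul c x _ hx =>
    rw [map_smul, coeff_smul, Finsupp.smul_apply]
    exact SMulMemClass.smul_mem c hx

theorem degreeHom_ne_zero {x : LPAU K s r} (hx : x ∈ lpa K s r) (hx0 : x ≠ 0) :
    degreeHom K s r x ≠ 0 := by
  intro h
  apply hx0
  rw [← sum_coeff_degreeHom K s r hx, h]
  simp

theorem coeff_degreeHom_central {z : LPAU K s r}
    (hz : ∀ x ∈ lpa K s r, z * x = x * z) (n : ℤ) {x : LPAU K s r} (hx : x ∈ lpa K s r) :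
    (degreeHom K s r z).coeff n * x = x * (degreeHom K s r z).coeff n := by
  have hsingle : ∀ d x, x ∈ lpa K s r → degreeHom K s r x = single d x →
      (degreeHom K s r z).coeff n * x = x * (degreeHom K s r z).coeff n := by
    intro d x hx hd
    have h := congrArg (degreeHom K s r) (hz x hx)
    rw [map_mul, map_mul, hd] at h
    have h' := DFunLike.congr_fun (congrArg coeff h) (n + d)
    rwa [coeff_mul_single_eq_coeff_mul n (by intros; omega),
      coeff_single_mul_eq_mul_coeff n (by intros; omega)] at h'
  induction hx using NonUnitalAlgebra.adjoin_induction with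
  | mem x hx =>
    obtain ⟨g, rfl⟩ := hx
    cases g with
    | vertex v => exact hsingle _ _ (vertexEl_mem_lpa K s r v) (degreeHom_vertexEl K s r v)
    | edge e => exact hsingle _ _ (edgeEl_mem_lpa K s r e) (degreeHom_edgeEl K s r e)
    | ghost e => exact hsingle _ _ (ghostEl_mem_lpa K s r e) (degreeHom_ghostEl K s r e)
  | zero => rw [mul_zero, zero_mul]
  | add x y _ _ hx hy => rw [mul_add, add_mul, hx, hy]
  | mul x y _ _ hx hy => rw [← mul_assoc, hx, mul_assoc, hy, mul_assoc]
  | smul c x _ hx => rw [mul_smul_comm, smul_mul_assoc, hx]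

end Grading

section Compression

variable (f : V → E)

/-- The path of length `n` starting at `v` whose edges are selected by `f`. -/
def selectedPath : ℕ → V → LPAU K s r
  | 0, v => vertexEl K s r v
  | n + 1, v => edgeEl K s r (f v) * selectedPath n (r (f v))

/-- The ghost path of `selectedPath`. -/
def selectedGhostPath : ℕ → V → LPAU K s r
  | 0, v => vertexEl K s r v
  | n + 1, v => selectedGhostPath n (r (f v)) * ghostEl K s r (f v)

/-- The final vertex of `selectedPath`. -/
def selectedEnd : ℕ → V → V
  | 0, v => v
  | n + 1, v => selectedEnd n (r (f v))

variable {f}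

theorem vertexEl_mul_selectedPath (hf : ∀ v, s (f v) = v) (n : ℕ) (v : V) :
    vertexEl K s r v * selectedPath K s r f n v = selectedPath K s r f n v := by
  cases n with
  | zero => exact vertexEl_mul_self K s r v
  | succ n =>
    rw [selectedPath, ← mul_assoc]
    have := vertexEl_mul_edgeEl K s r (f v)
    rw [hf v] at this
    rw [this]

theorem selectedGhostPath_mul_selectedPath (hf : ∀ v, s (f v) = v) (n : ℕ) (v : V) :
    selectedGhostPath K s r f n v * selectedPath K s r f n v =
      vertexEl K s r (selectedEnd r f n v) := by
  induction n generalizing v with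
  | zero => exact vertexEl_mul_self K s r v
  | succ n ih =>
    rw [selectedGhostPath, selectedPath, mul_assoc, ← mul_assoc (ghostEl K s r _),
      ghostEl_mul_edgeEl_self, vertexEl_mul_selectedPath K s r hf, ih, selectedEnd]

theorem selectedGhostPath_mem_lpa (n : ℕ) (v : V) : selectedGhostPath K s r f n v ∈ lpa K s r := by
  induction n generalizing v with
  | zero => exact vertexEl_mem_lpa K s r v
  | succ n ih => exact mul_mem (ih _) (ghostEl_mem_lpa K s r _)

theorem selectedGhostPath_mul_vertexEl (hf : ∀ v, s (f v) = v) (n : ℕ) (v : V) :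
    selectedGhostPath K s r f n v * vertexEl K s r v = selectedGhostPath K s r f n v := by
  cases n with
  | zero => exact vertexEl_mul_self K s r v
  | succ n =>
    rw [selectedGhostPath, mul_assoc]
    congr 1
    have := ghostEl_mul_vertexEl K s r (f v)
    rwa [hf v] at this

theorem compress_pathMonomial (hf : ∀ v, s (f v) = v) (n m : ℕ) (hnm : n ≤ m) (a b : List E)
    (ha : a.length = n) (hb : b.length = n) (w v : V) :
    ∃ k : K, selectedGhostPath K s r f m v * pathMonomial K s r a w b * selectedPath K s r f m v =
      k • vertexEl K s r (selectedEnd r f m v) := by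
  induction n generalizing m a b v with
  | zero =>
    obtain rfl := List.length_eq_zero_iff.mp ha
    obtain rfl := List.length_eq_zero_iff.mp hb
    rw [pathMonomial_nil]
    by_cases h : w = v
    · subst h
      refine ⟨1, ?_⟩
      rw [mul_assoc, vertexEl_mul_selectedPath K s r hf,
        selectedGhostPath_mul_selectedPath K s r hf, one_smul]
    · refine ⟨0, ?_⟩
      rw [mul_assoc, ← vertexEl_mul_selectedPath K s r hf, ← mul_assoc (vertexEl K s r w),
        vertexEl_mul_of_ne K s r h, zero_mul, mul_zero, zero_smul]
  | succ n ih =>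
    obtain ⟨m, rfl⟩ : ∃ m', m = m' + 1 := ⟨m - 1, by omega⟩
    obtain ⟨e, a, rfl⟩ := List.exists_cons_of_length_eq_add_one ha
    obtain ⟨b, e', rfl⟩ : ∃ b' e', b = b' ++ [e'] := by
      rcases List.eq_nil_or_concat b with rfl | ⟨b', e', h⟩
      · simp at hb
      · exact ⟨b', e', by simpa using h⟩
    have hsplit : selectedGhostPath K s r f (m + 1) v * pathMonomial K s r (e :: a) w (b ++ [e']) *
        selectedPath K s r f (m + 1) v =
        selectedGhostPath K s r f m (r (f v)) * (ghostEl K s r (f v) * edgeEl K s r e) *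
          pathMonomial K s r a w b * (ghostEl K s r e' * edgeEl K s r (f v)) *
          selectedPath K s r f m (r (f v)) := by
      rw [selectedGhostPath, selectedPath, pathMonomial_cons, pathMonomial_concat]
      simp only [mul_assoc]
    rw [hsplit]
    by_cases h1 : f v = e
    · by_cases h2 : e' = f v
      · subst h1 h2
        obtain ⟨k, hk⟩ := ih m (by omega) a b (by simpa using ha) (by simpa using hb) (r (f v))
        refine ⟨k, ?_⟩
        rw [ghostEl_mul_edgeEl_self, selectedGhostPath_mul_vertexEl K s r hf, mul_assoc,
          vertexEl_mul_selectedPath K s r hf, hk, selectedEnd]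
      · refine ⟨0, ?_⟩
        rw [ghostEl_mul_edgeEl_of_ne K s r h2, mul_zero, zero_mul, zero_smul]
    · refine ⟨0, ?_⟩
      rw [ghostEl_mul_edgeEl_of_ne K s r h1, mul_zero, zero_mul, zero_mul, zero_mul, zero_smul]

theorem compress_coeff_zero_degreeHom (hf : ∀ v, s (f v) = v) (v : V) {x : LPAU K s r}
    (hx : x ∈ lpa K s r) :
    ∃ N, ∀ m ≥ N, ∃ k : K, selectedGhostPath K s r f m v * (degreeHom K s r x).coeff 0 *
      selectedPath K s r f m v = k • vertexEl K s r (selectedEnd r f m v) := by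
  replace hx := mem_monomialSpan_of_mem_lpa K s r hx
  induction hx using Submodule.span_induction with
  | mem x hx =>
    obtain ⟨a, w, b, rfl⟩ := hx
    refine ⟨a.length, fun m hm => ?_⟩
    rw [degreeHom_pathMonomial, AddMonoidAlgebra.coeff_single]
    by_cases h : a.length = b.length
    · rw [h, sub_self, Finsupp.single_eq_same]
      exact compress_pathMonomial K s r hf _ m hm a b rfl h.symm w v
    · refine ⟨0, ?_⟩
      rw [Finsupp.single_eq_of_ne (by omega), mul_zero, zero_mul, zero_smul]
  | zero => exact ⟨0, fun m _ => ⟨0, by simp⟩⟩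
  | add x y _ _ hx hy =>
    obtain ⟨N, hN⟩ := hx
    obtain ⟨M, hM⟩ := hy
    refine ⟨max N M, fun m hm => ?_⟩
    obtain ⟨k, hk⟩ := hN m (le_trans (le_max_left _ _) hm)
    obtain ⟨l, hl⟩ := hM m (le_trans (le_max_right _ _) hm)
    refine ⟨k + l, ?_⟩
    rw [map_add, AddMonoidAlgebra.coeff_add, Finsupp.add_apply, mul_add, add_mul, hk, hl, add_smul]
  | smul c x _ hx =>
    obtain ⟨N, hN⟩ := hx
    refine ⟨N, fun m hm => ?_⟩
    obtain ⟨k, hk⟩ := hN m hm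
    refine ⟨c * k, ?_⟩
    rw [map_smul, AddMonoidAlgebra.coeff_smul, Finsupp.smul_apply, mul_smul_comm, smul_mul_assoc, hk,
      mul_smul]

theorem compress_sink {w : V} (hw : ∀ e, s e ≠ w) {x : LPAU K s r} (hx : x ∈ lpa K s r) :
    ∃ k : K, vertexEl K s r w * x * vertexEl K s r w = k • vertexEl K s r w := by
  replace hx := mem_monomialSpan_of_mem_lpa K s r hx
  induction hx using Submodule.span_induction with
  | mem x hx =>
    obtain ⟨a, v, b, rfl⟩ := hx
    cases a with
    | cons e a =>
      refine ⟨0, ?_⟩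
      rw [pathMonomial_cons, ← mul_assoc, vertexEl_mul_edgeEl_of_ne K s r (hw e).symm, zero_mul,
        zero_mul, zero_smul]
    | nil =>
      rcases List.eq_nil_or_concat b with rfl | ⟨b, e, rfl⟩
      · rw [pathMonomial_nil]
        by_cases h : w = v
        · subst h
          exact ⟨1, by simp only [vertexEl_mul_self, one_smul]⟩
        · exact ⟨0, by rw [vertexEl_mul_of_ne K s r h, zero_mul, zero_smul]⟩
      · refine ⟨0, ?_⟩
        rw [List.concat_eq_append, pathMonomial_concat, mul_assoc, mul_assoc,
          ghostEl_mul_vertexEl_of_ne K s r (hw e), mul_zero, mul_zero, zero_smul]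
  | zero => exact ⟨0, by simp⟩
  | add x y _ _ hx hy =>
    obtain ⟨k, hk⟩ := hx
    obtain ⟨l, hl⟩ := hy
    exact ⟨k + l, by rw [mul_add, add_mul, hk, hl, add_smul]⟩
  | smul c x _ hx =>
    obtain ⟨k, hk⟩ := hx
    exact ⟨c * k, by rw [mul_smul_comm, smul_mul_assoc, hk, mul_smul]⟩

end Compression

section LocalUnits

theorem sum_vertexEl_mul_vertexEl {S : Finset V} {w : V} (hw : w ∈ S) :
    (∑ v ∈ S, vertexEl K s r v) * vertexEl K s r w = vertexEl K s r w := by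
  rw [Finset.sum_mul, Finset.sum_eq_single_of_mem w hw, vertexEl_mul_self]
  exact fun v _ h => vertexEl_mul_of_ne K s r h

theorem vertexEl_mul_sum_vertexEl {S : Finset V} {w : V} (hw : w ∈ S) :
    vertexEl K s r w * (∑ v ∈ S, vertexEl K s r v) = vertexEl K s r w := by
  rw [Finset.mul_sum, Finset.sum_eq_single_of_mem w hw, vertexEl_mul_self]
  exact fun v _ h => vertexEl_mul_of_ne K s r h.symm

theorem sum_vertexEl_mem_lpa (S : Finset V) : ∑ v ∈ S, vertexEl K s r v ∈ lpa K s r :=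
  sum_mem fun v _ => vertexEl_mem_lpa K s r v

theorem exists_local_unit {x : LPAU K s r} (hx : x ∈ lpa K s r) :
    ∃ F : Finset V, ∀ S, F ⊆ S →
      (∑ v ∈ S, vertexEl K s r v) * x = x ∧ x * (∑ v ∈ S, vertexEl K s r v) = x := by
  classical
  induction hx using NonUnitalAlgebra.adjoin_induction with
  | mem x hx =>
    obtain ⟨g, rfl⟩ := hx
    cases g with
    | vertex v =>
      refine ⟨{v}, fun S hS => ?_⟩
      have hv := hS (Finset.mem_singleton_self v)
      exact ⟨sum_vertexEl_mul_vertexEl K s r hv, vertexEl_mul_sum_vertexEl K s r hv⟩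
    | edge e =>
      refine ⟨{s e, r e}, fun S hS => ?_⟩
      rw [← edgeEl]
      constructor
      · rw [← vertexEl_mul_edgeEl, ← mul_assoc,
          sum_vertexEl_mul_vertexEl K s r (hS (by simp))]
      · rw [← edgeEl_mul_vertexEl, mul_assoc,
          vertexEl_mul_sum_vertexEl K s r (hS (by simp))]
    | ghost e =>
      refine ⟨{s e, r e}, fun S hS => ?_⟩
      rw [← ghostEl]
      constructor
      · rw [← vertexEl_mul_ghostEl, ← mul_assoc,
          sum_vertexEl_mul_vertexEl K s r (hS (by simp))]
      · rw [← ghostEl_mul_vertexEl, mul_assoc,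
          vertexEl_mul_sum_vertexEl K s r (hS (by simp))]
  | zero => exact ⟨∅, fun S _ => ⟨mul_zero _, zero_mul _⟩⟩
  | add x y _ _ hx hy =>
    obtain ⟨F, hF⟩ := hx
    obtain ⟨G, hG⟩ := hy
    refine ⟨F ∪ G, fun S hS => ?_⟩
    have h1 := hF S (Finset.union_subset_left hS)
    have h2 := hG S (Finset.union_subset_right hS)
    exact ⟨by rw [mul_add, h1.1, h2.1], by rw [add_mul, h1.2, h2.2]⟩
  | mul x y _ _ hx hy =>
    obtain ⟨F, hF⟩ := hx
    obtain ⟨G, hG⟩ := hy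
    refine ⟨F ∪ G, fun S hS => ?_⟩
    have h1 := hF S (Finset.union_subset_left hS)
    have h2 := hG S (Finset.union_subset_right hS)
    exact ⟨by rw [← mul_assoc, h1.1], by rw [mul_assoc, h2.2]⟩
  | smul c x _ hx =>
    obtain ⟨F, hF⟩ := hx
    refine ⟨F, fun S hS => ?_⟩
    exact ⟨by rw [mul_smul_comm, (hF S hS).1], by rw [smul_mul_assoc, (hF S hS).2]⟩

theorem sum_univ_vertexEl_mul (hfin : (Set.univ : Set V).Finite) {x : LPAU K s r}
    (hx : x ∈ lpa K s r) :
    (∑ v ∈ hfin.toFinset, vertexEl K s r v) * x = x ∧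
      x * (∑ v ∈ hfin.toFinset, vertexEl K s r v) = x := by
  obtain ⟨F, hF⟩ := exists_local_unit K s r hx
  exact hF _ fun v _ => by simp

end LocalUnits

section Center

theorem eq_zero_of_central_of_infinite (hrow : ∀ v : V, {e : E | s e = v}.Finite)
    (hsimple : ∀ I : Set ↥(lpa K s r), IsTwoSidedIdealSet I → I = {0} ∨ I = Set.univ)
    (hinf : (Set.univ : Set V).Infinite) {z : ↥(lpa K s r)} (hz : ∀ x, z * x = x * z) :
    z = 0 := by
  obtain ⟨F, hF⟩ := exists_local_unit K s r z.2
  have hzF := (hF F subset_rfl).2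
  obtain ⟨v, -, hv⟩ := hinf.exists_notMem_finset F
  have hzv : z * vertexIn K s r v = 0 := by
    apply Subtype.ext
    change (z : LPAU K s r) * vertexEl K s r v = 0
    rw [← hzF, mul_assoc, Finset.sum_mul, Finset.sum_eq_zero, mul_zero]
    rintro w hw
    exact vertexEl_mul_of_ne K s r (by rintro rfl; exact hv hw)
  have hv0 : vertexIn K s r v ≠ 0 := fun h =>
    vertexEl_ne_zero K s r hrow v (congrArg Subtype.val h)
  have h := central_mul_eq_zero_of_simple hsimple hz hv0 hzv
    ⟨∑ v ∈ F, vertexEl K s r v, sum_vertexEl_mem_lpa K s r F⟩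
  exact Subtype.ext (hzF.symm.trans (congrArg Subtype.val h))

theorem exists_degree_of_central
    (hsimple : ∀ I : Set ↥(lpa K s r), IsTwoSidedIdealSet I → I = {0} ∨ I = Set.univ)
    (hfin : (Set.univ : Set V).Finite) {z : ↥(lpa K s r)} (hz : ∀ x, z * x = x * z)
    (hz0 : z ≠ 0) :
    ∃ N, ∀ n, (degreeHom K s r z).coeff n ≠ 0 → n = N := by
  have hu := fun x : ↥(lpa K s r) => sum_univ_vertexEl_mul K s r hfin x.2
  obtain ⟨y, hy, hzy⟩ := exists_central_inverse_of_simple hsimple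
    (u := ⟨∑ v ∈ hfin.toFinset, vertexEl K s r v, sum_vertexEl_mem_lpa K s r _⟩)
    (fun x => ⟨Subtype.ext (hu x).1, Subtype.ext (hu x).2⟩) hz hz0
  have hzy' : (z : LPAU K s r) * y = ∑ v ∈ hfin.toFinset, vertexEl K s r v :=
    congrArg Subtype.val hzy
  have hy0 : y ≠ 0 := by
    rintro rfl
    apply hz0
    apply Subtype.ext
    rw [← (hu z).2, ← hzy']
    change (z : LPAU K s r) * (z * 0) = 0
    rw [mul_zero, mul_zero]
  refine eq_single_of_mul_eq_single
    (u := ∑ v ∈ hfin.toFinset, vertexEl K s r v)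
    (degreeHom_ne_zero K s r z.2 fun h => hz0 (Subtype.ext h))
    (degreeHom_ne_zero K s r y.2 fun h => hy0 (Subtype.ext h)) ?_ ?_
  · rw [← map_mul, hzy', map_sum]
    simp only [degreeHom_vertexEl]
    exact (map_sum (AddMonoidAlgebra.singleAddHom (0 : ℤ)) _ _).symm
  · intro a b ha hb hab
    have hzc : ∀ x ∈ lpa K s r, (z : LPAU K s r) * x = x * z := fun x hx =>
      congrArg Subtype.val (hz ⟨x, hx⟩)
    let c : ↥(lpa K s r) := ⟨_, coeff_degreeHom_mem_lpa K s r z.2 a⟩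
    let d : ↥(lpa K s r) := ⟨_, coeff_degreeHom_mem_lpa K s r y.2 b⟩
    have h := central_mul_eq_zero_of_simple hsimple (z := c) (x := d)
      (fun x => Subtype.ext (coeff_degreeHom_central K s r hzc a x.2))
      (fun h => hb (congrArg Subtype.val h)) (Subtype.ext hab)
      ⟨∑ v ∈ hfin.toFinset, vertexEl K s r v, sum_vertexEl_mem_lpa K s r _⟩
    exact ha ((hu c).2.symm.trans (congrArg Subtype.val h))

theorem coeff_zero_degreeHom_of_central (hrow : ∀ v : V, {e : E | s e = v}.Finite)
    (hsimple : ∀ I : Set ↥(lpa K s r), IsTwoSidedIdealSet I → I = {0} ∨ I = Set.univ)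
    (hfin : (Set.univ : Set V).Finite) (v : V) {z : ↥(lpa K s r)} (hz : ∀ x, z * x = x * z) :
    (degreeHom K s r z).coeff 0 = z := by
  have hu := fun x : ↥(lpa K s r) => sum_univ_vertexEl_mul K s r hfin x.2
  set u := ∑ v ∈ hfin.toFinset, vertexEl K s r v with hu_def
  have hu_mem : u ∈ lpa K s r := sum_vertexEl_mem_lpa K s r _
  have hu0 : u ≠ 0 := fun h => vertexEl_ne_zero K s r hrow v (by
    have := (hu (vertexIn K s r v)).1
    rw [h, zero_mul] at this
    exact this.symm)
  have hdu : degreeHom K s r u = AddMonoidAlgebra.single 0 u := by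
    rw [hu_def, map_sum]
    simp only [degreeHom_vertexEl]
    exact (map_sum (AddMonoidAlgebra.singleAddHom (0 : ℤ)) _ _).symm
  have hsupp : ∀ n, n ≠ 0 → (degreeHom K s r z).coeff n = 0 := by
    intro n hn
    by_contra hne
    have hz0 : z ≠ 0 := by
      rintro rfl
      apply hne
      change (degreeHom K s r 0).coeff n = 0
      simp
    obtain ⟨N, hN⟩ := exists_degree_of_central K s r hsimple hfin hz hz0
    have h0 : (degreeHom K s r z).coeff 0 = 0 := by
      by_contra h0
      exact hn ((hN n hne).trans (hN 0 h0).symm)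
    let w : ↥(lpa K s r) := z + ⟨u, hu_mem⟩
    have hdw : ∀ m, (degreeHom K s r w).coeff m =
        (degreeHom K s r z).coeff m + Finsupp.single 0 u m := by
      intro m
      change (degreeHom K s r ((z : LPAU K s r) + u)).coeff m = _
      rw [map_add, hdu]
      rfl
    have hwn : (degreeHom K s r w).coeff n ≠ 0 := by
      rwa [hdw, Finsupp.single_eq_of_ne hn, add_zero]
    have hw0 : (degreeHom K s r w).coeff 0 ≠ 0 := by
      rwa [hdw, h0, Finsupp.single_eq_same, zero_add]
    have hw : ∀ x, w * x = x * w := by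
      intro x
      apply Subtype.ext
      have := congrArg Subtype.val (hz x)
      change ((z : LPAU K s r) + u) * x = x * (z + u)
      change (z : LPAU K s r) * x = x * z at this
      rw [add_mul, mul_add, this, (hu x).1, (hu x).2]
    obtain ⟨M, hM⟩ := exists_degree_of_central K s r hsimple hfin hw (by
      intro h
      apply hw0
      rw [h]
      change (degreeHom K s r 0).coeff 0 = 0
      simp)
    exact hn ((hM n hwn).trans (hM 0 hw0).symm)
  conv_rhs => rw [← sum_coeff_degreeHom K s r z.2]
  symm
  refine Finsupp.sum_eq_single 0 (fun n hn h => absurd (hsupp n h) ?_) fun _ => rfl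
  exact hn

theorem exists_vertexEl_eigenvector {z : LPAU K s r} (hz_mem : z ∈ lpa K s r)
    (hz : ∀ x ∈ lpa K s r, z * x = x * z) (hdeg : (degreeHom K s r z).coeff 0 = z) (v : V) :
    ∃ (w : V) (k : K), z * vertexEl K s r w = k • vertexEl K s r w := by
  by_cases hsink : ∃ w, ∀ e, s e ≠ w
  · obtain ⟨w, hw⟩ := hsink
    obtain ⟨k, hk⟩ := compress_sink K s r hw hz_mem
    refine ⟨w, k, ?_⟩
    rw [← hk, ← hz _ (vertexEl_mem_lpa K s r w), mul_assoc, vertexEl_mul_self]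
  · push Not at hsink
    choose f hf using hsink
    obtain ⟨N, hN⟩ := compress_coeff_zero_degreeHom K s r hf v hz_mem
    obtain ⟨k, hk⟩ := hN N le_rfl
    refine ⟨selectedEnd r f N v, k, ?_⟩
    rw [← hk, hdeg, ← hz _ (selectedGhostPath_mem_lpa K s r N v), mul_assoc,
      selectedGhostPath_mul_selectedPath K s r hf]

theorem exists_scalar_of_central_of_finite (hrow : ∀ v : V, {e : E | s e = v}.Finite)
    (hsimple : ∀ I : Set ↥(lpa K s r), IsTwoSidedIdealSet I → I = {0} ∨ I = Set.univ)
    (hfin : (Set.univ : Set V).Finite) {z : ↥(lpa K s r)} (hz : ∀ x, z * x = x * z) :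
    ∃ k : K, (z : LPAU K s r) = k • ∑ v ∈ hfin.toFinset, vertexEl K s r v := by
  have hu := fun x : ↥(lpa K s r) => sum_univ_vertexEl_mul K s r hfin x.2
  rcases isEmpty_or_nonempty V with hV | ⟨⟨v⟩⟩
  · refine ⟨0, ?_⟩
    rw [← (hu z).1, Finset.sum_eq_zero (fun v => hV.elim v), zero_mul, smul_zero]
  · have hzc : ∀ x ∈ lpa K s r, (z : LPAU K s r) * x = x * z := fun x hx =>
      congrArg Subtype.val (hz ⟨x, hx⟩)
    obtain ⟨w, k, hk⟩ := exists_vertexEl_eigenvector K s r z.2 hzc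
      (coeff_zero_degreeHom_of_central K s r hrow hsimple hfin v hz) v
    refine ⟨k, ?_⟩
    set u : ↥(lpa K s r) :=
      ⟨∑ v ∈ hfin.toFinset, vertexEl K s r v, sum_vertexEl_mem_lpa K s r _⟩ with hu_def
    have hux : ∀ x, u * x = x := fun x => Subtype.ext (hu x).1
    have hxu : ∀ x, x * u = x := fun x => Subtype.ext (hu x).2
    have hkv : z * vertexIn K s r w = k • vertexIn K s r w := Subtype.ext hk
    have h := central_mul_eq_zero_of_simple hsimple (z := z - k • u) (x := vertexIn K s r w)
      (fun x => by
        rw [sub_mul, mul_sub, hz, smul_mul_assoc, mul_smul_comm, hux, hxu])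
      (fun h => vertexEl_ne_zero K s r hrow w (congrArg Subtype.val h))
      (by rw [sub_mul, smul_mul_assoc, hux, hkv, sub_self]) u
    rw [hxu, sub_eq_zero] at h
    exact congrArg Subtype.val h

end Center

/-- **The center of a simple Leavitt path algebra** (Aranda Pino–Crow).  Let `E` be a
row-finite graph and `K` a field such that `L_K(E)` is simple.  If `E⁰` is finite then
the center of `L_K(E)` is `K · 1` (the scalar multiples of the identity `∑_{v ∈ E⁰} v`),
and if `E⁰` is infinite then the center of `L_K(E)` is `{0}`. -/
theorem center_of_simple_lpa (K V E : Type) [Field K] (s r : E → V)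
    (hrow : ∀ v : V, {e : E | s e = v}.Finite)
    (hsimple : ∀ I : Set ↥(lpa K s r), IsTwoSidedIdealSet I → I = {0} ∨ I = Set.univ) :
    (∀ hfin : (Set.univ : Set V).Finite,
        {z : ↥(lpa K s r) | ∀ x : ↥(lpa K s r), z * x = x * z} =
          {z : ↥(lpa K s r) | ∃ k : K,
            (z : LPAU K s r) = k • hfin.toFinset.sum fun v => vertexEl K s r v}) ∧
      ((Set.univ : Set V).Infinite →
        {z : ↥(lpa K s r) | ∀ x : ↥(lpa K s r), z * x = x * z} = {0}) := by
  refine ⟨fun hfin => ?_, fun hinf => ?_⟩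
  · ext z
    refine ⟨fun hz => exists_scalar_of_central_of_finite K s r hrow hsimple hfin hz, ?_⟩
    rintro ⟨k, hk⟩ x
    apply Subtype.ext
    change (z : LPAU K s r) * x = x * z
    obtain ⟨h1, h2⟩ := sum_univ_vertexEl_mul K s r hfin x.2
    rw [hk, smul_mul_assoc, mul_smul_comm, h1, h2]
  · ext z
    refine ⟨fun hz => eq_zero_of_central_of_infinite K s r hrow hsimple hinf hz, ?_⟩
    rintro rfl x
    rw [zero_mul, mul_zero]
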